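/- arXiv:2511.05087 — 2 statements merged into one kernel-verified Lean document; each statement's English description precedes it below -/
import Mathlib

section
/- Let H ∈ [3/4, 1). Then N(T)/(2T) → ∞ as T → ∞; in particular the limit lim_{T→∞} N(T)/(2T) does not exist as a finite number. -/
open Real MeasureTheory intervalIntegral Filter

/-- `fBmNormSq H T` is the squared norm `‖f_T‖²` expressed as the fourfold integral,
for `H ∈ (1/2,1)`. -/
noncomputable def fBmNormSq (H T : ℝ) : ℝ :=
  H ^ 2 * (2 * H - 1) ^ 2 *
    ∫ t₁ in (0:ℝ)..T, ∫ t₂ in (0:ℝ)..T, ∫ s₁ in (0:ℝ)..T, ∫ s₂ in (0:ℝ)..T,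
      Real.exp (-|t₁ - s₁| - |t₂ - s₂|) * |t₂ - t₁| ^ (2 * H - 2) * |s₁ - s₂| ^ (2 * H - 2)

theorem intervalIntegrable_abs_rpow {r : ℝ} (hr : -1 < r) (a b : ℝ) :
    IntervalIntegrable (fun u : ℝ => |u| ^ r) volume a b := by
  have hpos : ∀ c : ℝ, 0 ≤ c → IntervalIntegrable (fun u : ℝ => |u| ^ r) volume 0 c := by
    intro c hc
    refine (intervalIntegrable_rpow' (a := 0) (b := c) hr).congr ?_
    intro u hu
    rw [Set.uIoc_of_le hc] at hu
    simp only [abs_of_pos hu.1]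
  have hall : ∀ c : ℝ, IntervalIntegrable (fun u : ℝ => |u| ^ r) volume 0 c := by
    intro c
    rcases le_total 0 c with hc | hc
    · exact hpos c hc
    · rw [IntervalIntegrable.iff_comp_neg]
      simpa using hpos (-c) (by linarith)
  exact (hall a).symm.trans (hall b)

theorem intervalIntegrable_abs_sub_rpow {r : ℝ} (hr : -1 < r) (x a b : ℝ) :
    IntervalIntegrable (fun s : ℝ => |x - s| ^ r) volume a b := by
  simpa using (intervalIntegrable_abs_rpow hr (x - a) (x - b)).comp_sub_left x

theorem integral_abs_sub_rpow_le {r T x : ℝ} (hr : -1 < r) (hx : x ∈ Set.Icc 0 T) :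
    ∫ s in (0:ℝ)..T, |x - s| ^ r ≤ ∫ u in (-T)..T, |u| ^ r := by
  rw [intervalIntegral.integral_comp_sub_left (fun u : ℝ => |u| ^ r) x]
  refine integral_mono_interval (by linarith [hx.1]) (by linarith [hx.1, hx.2])
    (by linarith [hx.2]) (Eventually.of_forall fun u => ?_) (intervalIntegrable_abs_rpow hr _ _)
  simp only [Pi.zero_apply]
  positivity

theorem integral_le_integral_of_subinterval {f g : ℝ → ℝ} {a b c d : ℝ} (hca : c ≤ a) (hab : a ≤ b)
    (hbd : b ≤ d) (hf : IntervalIntegrable f volume c d) (hf0 : ∀ x, 0 ≤ f x)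
    (hg : IntervalIntegrable g volume a b) (hgf : ∀ x ∈ Set.Icc a b, g x ≤ f x) :
    ∫ x in a..b, g x ≤ ∫ x in c..d, f x := by
  have hsub : Set.uIcc a b ⊆ Set.uIcc c d := by
    rw [Set.uIcc_of_le hab, Set.uIcc_of_le (hca.trans (hab.trans hbd))]
    exact Set.Icc_subset_Icc hca hbd
  exact (integral_mono_on hab hg (hf.mono_set hsub) hgf).trans
    (integral_mono_interval hca hab hbd (Eventually.of_forall hf0) hf)

theorem intervalIntegrable_of_bound {f g : ℝ → ℝ} {T : ℝ} (hT : 0 ≤ T) (hf : StronglyMeasurable f)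
    (hf0 : ∀ x, 0 ≤ f x) (hg : IntervalIntegrable g volume 0 T)
    (hfg : ∀ x ∈ Set.Icc 0 T, f x ≤ g x) : IntervalIntegrable f volume 0 T := by
  refine hg.mono_fun' hf.aestronglyMeasurable ?_
  rw [Set.uIoc_of_le hT]
  refine (ae_restrict_iff' measurableSet_Ioc).2 (Eventually.of_forall fun x hx => ?_)
  simp only [Real.norm_of_nonneg (hf0 x)]
  exact hfg x (Set.Ioc_subset_Icc_self hx)

/-- The integrand of `fBmNormSq`, with `r` in place of the exponent `2 * H - 2`. -/
noncomputable def fBmKernel (r t₁ t₂ s₁ s₂ : ℝ) : ℝ :=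
  Real.exp (-|t₁ - s₁| - |t₂ - s₂|) * |t₂ - t₁| ^ r * |s₁ - s₂| ^ r

/-- `fBmKernel` integrated over `s₂`. -/
noncomputable def fBmKernelInt₁ (r T t₁ t₂ s₁ : ℝ) : ℝ :=
  ∫ s₂ in (0:ℝ)..T, fBmKernel r t₁ t₂ s₁ s₂

/-- `fBmKernel` integrated over `s₁, s₂`. -/
noncomputable def fBmKernelInt₂ (r T t₁ t₂ : ℝ) : ℝ :=
  ∫ s₁ in (0:ℝ)..T, fBmKernelInt₁ r T t₁ t₂ s₁

/-- `fBmKernel` integrated over `t₂, s₁, s₂`. -/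
noncomputable def fBmKernelInt₃ (r T t₁ : ℝ) : ℝ :=
  ∫ t₂ in (0:ℝ)..T, fBmKernelInt₂ r T t₁ t₂

section

variable {r T : ℝ}

theorem fBmKernel_nonneg (t₁ t₂ s₁ s₂ : ℝ) : 0 ≤ fBmKernel r t₁ t₂ s₁ s₂ := by
  unfold fBmKernel; positivity

theorem fBmKernelInt₁_nonneg (hT : 0 ≤ T) (t₁ t₂ s₁ : ℝ) : 0 ≤ fBmKernelInt₁ r T t₁ t₂ s₁ :=
  integral_nonneg hT fun _ _ => fBmKernel_nonneg _ _ _ _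

theorem fBmKernelInt₂_nonneg (hT : 0 ≤ T) (t₁ t₂ : ℝ) : 0 ≤ fBmKernelInt₂ r T t₁ t₂ :=
  integral_nonneg hT fun _ _ => fBmKernelInt₁_nonneg hT _ _ _

theorem fBmKernelInt₃_nonneg (hT : 0 ≤ T) (t₁ : ℝ) : 0 ≤ fBmKernelInt₃ r T t₁ :=
  integral_nonneg hT fun _ _ => fBmKernelInt₂_nonneg hT _ _

theorem stronglyMeasurable_fBmKernel : StronglyMeasurable
    (fun p : ((ℝ × ℝ) × ℝ) × ℝ => fBmKernel r p.1.1.1 p.1.1.2 p.1.2 p.2) := by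
  unfold fBmKernel
  apply Measurable.stronglyMeasurable
  have h : Measurable fun x : ℝ => |x| := continuous_abs.measurable
  fun_prop

theorem stronglyMeasurable_fBmKernelInt₁ (hT : 0 ≤ T) : StronglyMeasurable
    (fun p : (ℝ × ℝ) × ℝ => fBmKernelInt₁ r T p.1.1 p.1.2 p.2) := by
  simp only [fBmKernelInt₁, integral_of_le hT]
  exact stronglyMeasurable_fBmKernel.integral_prod_right'

theorem stronglyMeasurable_fBmKernelInt₂ (hT : 0 ≤ T) : StronglyMeasurable
    (fun p : ℝ × ℝ => fBmKernelInt₂ r T p.1 p.2) := by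
  simp only [fBmKernelInt₂, integral_of_le hT]
  exact (stronglyMeasurable_fBmKernelInt₁ hT).integral_prod_right'

theorem stronglyMeasurable_fBmKernelInt₃ (hT : 0 ≤ T) :
    StronglyMeasurable (fBmKernelInt₃ r T) := by
  unfold fBmKernelInt₃
  simp only [integral_of_le hT]
  exact (stronglyMeasurable_fBmKernelInt₂ hT).integral_prod_right'

theorem fBmKernel_le (t₁ t₂ s₁ s₂ : ℝ) :
    fBmKernel r t₁ t₂ s₁ s₂ ≤ |t₂ - t₁| ^ r * |s₁ - s₂| ^ r := by
  have h : Real.exp (-|t₁ - s₁| - |t₂ - s₂|) ≤ 1 :=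
    Real.exp_le_one_iff.2 (by linarith [abs_nonneg (t₁ - s₁), abs_nonneg (t₂ - s₂)])
  unfold fBmKernel
  rw [mul_assoc]
  exact mul_le_of_le_one_left (by positivity) h

theorem intervalIntegrable_fBmKernel (hr : -1 < r) (hT : 0 ≤ T) (t₁ t₂ s₁ : ℝ) :
    IntervalIntegrable (fBmKernel r t₁ t₂ s₁) volume 0 T :=
  intervalIntegrable_of_bound hT
    (stronglyMeasurable_fBmKernel.comp_measurable
      (g := fun s₂ : ℝ => (((t₁, t₂), s₁), s₂)) (by fun_prop))
    (fBmKernel_nonneg t₁ t₂ s₁)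
    ((intervalIntegrable_abs_sub_rpow hr s₁ 0 T).const_mul (|t₂ - t₁| ^ r))
    (fun s₂ _ => fBmKernel_le t₁ t₂ s₁ s₂)

theorem fBmKernelInt₁_le (hr : -1 < r) (hT : 0 ≤ T) (t₁ t₂ : ℝ) {s₁ : ℝ}
    (hs₁ : s₁ ∈ Set.Icc 0 T) :
    fBmKernelInt₁ r T t₁ t₂ s₁ ≤ |t₂ - t₁| ^ r * ∫ u in (-T)..T, |u| ^ r := by
  refine (integral_mono_on hT (intervalIntegrable_fBmKernel hr hT t₁ t₂ s₁)
    ((intervalIntegrable_abs_sub_rpow hr s₁ 0 T).const_mul (|t₂ - t₁| ^ r))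
    (fun s₂ _ => fBmKernel_le t₁ t₂ s₁ s₂)).trans ?_
  rw [intervalIntegral.integral_const_mul]
  exact mul_le_mul_of_nonneg_left (integral_abs_sub_rpow_le hr hs₁) (by positivity)

theorem intervalIntegrable_fBmKernelInt₁ (hr : -1 < r) (hT : 0 ≤ T) (t₁ t₂ : ℝ) :
    IntervalIntegrable (fBmKernelInt₁ r T t₁ t₂) volume 0 T :=
  intervalIntegrable_of_bound hT
    ((stronglyMeasurable_fBmKernelInt₁ hT).comp_measurable
      (g := fun s₁ : ℝ => ((t₁, t₂), s₁)) (by fun_prop))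
    (fBmKernelInt₁_nonneg hT t₁ t₂)
    (intervalIntegrable_const (c := |t₂ - t₁| ^ r * ∫ u in (-T)..T, |u| ^ r))
    (fun _ hs₁ => fBmKernelInt₁_le hr hT t₁ t₂ hs₁)

theorem fBmKernelInt₂_le (hr : -1 < r) (hT : 0 ≤ T) (t₁ t₂ : ℝ) :
    fBmKernelInt₂ r T t₁ t₂ ≤ (T * ∫ u in (-T)..T, |u| ^ r) * |t₁ - t₂| ^ r := by
  refine (integral_mono_on hT (intervalIntegrable_fBmKernelInt₁ hr hT t₁ t₂)
    intervalIntegrable_const (fun _ hs₁ => fBmKernelInt₁_le hr hT t₁ t₂ hs₁)).trans ?_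
  rw [intervalIntegral.integral_const, smul_eq_mul, abs_sub_comm t₂ t₁]
  exact le_of_eq (by ring)

theorem intervalIntegrable_fBmKernelInt₂ (hr : -1 < r) (hT : 0 ≤ T) (t₁ : ℝ) :
    IntervalIntegrable (fBmKernelInt₂ r T t₁) volume 0 T :=
  intervalIntegrable_of_bound hT
    ((stronglyMeasurable_fBmKernelInt₂ hT).comp_measurable
      (g := fun t₂ : ℝ => (t₁, t₂)) (by fun_prop))
    (fBmKernelInt₂_nonneg hT t₁)
    ((intervalIntegrable_abs_sub_rpow hr t₁ 0 T).const_mul _)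
    (fun t₂ _ => fBmKernelInt₂_le hr hT t₁ t₂)

theorem fBmKernelInt₃_le (hr : -1 < r) (hT : 0 ≤ T) {t₁ : ℝ} (ht₁ : t₁ ∈ Set.Icc 0 T) :
    fBmKernelInt₃ r T t₁ ≤ (T * ∫ u in (-T)..T, |u| ^ r) * ∫ u in (-T)..T, |u| ^ r := by
  refine (integral_mono_on hT (intervalIntegrable_fBmKernelInt₂ hr hT t₁)
    ((intervalIntegrable_abs_sub_rpow hr t₁ 0 T).const_mul _)
    (fun t₂ _ => fBmKernelInt₂_le hr hT t₁ t₂)).trans ?_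
  rw [intervalIntegral.integral_const_mul]
  have h0 : 0 ≤ ∫ u in (-T)..T, |u| ^ r :=
    integral_nonneg (by linarith) fun _ _ => by positivity
  exact mul_le_mul_of_nonneg_left (integral_abs_sub_rpow_le hr ht₁) (by positivity)

theorem intervalIntegrable_fBmKernelInt₃ (hr : -1 < r) (hT : 0 ≤ T) :
    IntervalIntegrable (fBmKernelInt₃ r T) volume 0 T :=
  intervalIntegrable_of_bound hT (stronglyMeasurable_fBmKernelInt₃ hT) (fBmKernelInt₃_nonneg hT)
    intervalIntegrable_const (fun _ ht₁ => fBmKernelInt₃_le hr hT ht₁)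

theorem le_fBmKernel (hr : -1 / 2 ≤ r) (hr0 : r ≤ 0) {t₁ t₂ s₁ s₂ : ℝ} (ht : t₁ + 3 ≤ t₂)
    (hs₁ : s₁ ∈ Set.Icc t₁ (t₁ + 1)) (hs₂ : s₂ ∈ Set.Icc (t₂ - 1) t₂) :
    Real.exp (-2) * (t₂ - t₁)⁻¹ ≤ fBmKernel r t₁ t₂ s₁ s₂ := by
  obtain ⟨h1, h2⟩ := hs₁
  obtain ⟨h3, h4⟩ := hs₂
  have hd : 0 < t₂ - t₁ := by linarith
  have hs : 0 < s₂ - s₁ := by linarith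
  have hexp : Real.exp (-2) ≤ Real.exp (-|t₁ - s₁| - |t₂ - s₂|) := by
    apply Real.exp_le_exp.2
    rw [abs_of_nonpos (by linarith : t₁ - s₁ ≤ 0), abs_of_nonneg (by linarith : 0 ≤ t₂ - s₂)]
    linarith
  have hpow : (t₂ - t₁) ^ r ≤ (s₂ - s₁) ^ r :=
    Real.rpow_le_rpow_of_nonpos hs (by linarith) hr0
  have hinv : (t₂ - t₁)⁻¹ ≤ (t₂ - t₁) ^ r * (t₂ - t₁) ^ r := by
    rw [← Real.rpow_add hd, ← Real.rpow_neg_one]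
    exact Real.rpow_le_rpow_of_exponent_le (by linarith) (by linarith)
  unfold fBmKernel
  rw [abs_of_pos hd, abs_sub_comm s₁, abs_of_pos hs, mul_assoc]
  refine mul_le_mul hexp (hinv.trans ?_) (by positivity) (by positivity)
  exact mul_le_mul_of_nonneg_left hpow (by positivity)

theorem le_fBmKernelInt₂ (hr : -1 / 2 ≤ r) (hr0 : r ≤ 0) {t₁ t₂ : ℝ} (ht₁ : 0 ≤ t₁)
    (ht : t₁ + 3 ≤ t₂) (ht₂ : t₂ ≤ T) :
    Real.exp (-2) * (t₂ - t₁)⁻¹ ≤ fBmKernelInt₂ r T t₁ t₂ := by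
  have hT : 0 ≤ T := by linarith
  have hr1 : -1 < r := by linarith
  have hint₁ : ∀ s₁ ∈ Set.Icc t₁ (t₁ + 1),
      Real.exp (-2) * (t₂ - t₁)⁻¹ ≤ fBmKernelInt₁ r T t₁ t₂ s₁ := by
    intro s₁ hs₁
    have h := integral_le_integral_of_subinterval (by linarith : (0:ℝ) ≤ t₂ - 1)
      (by linarith : t₂ - 1 ≤ t₂) ht₂ (intervalIntegrable_fBmKernel hr1 hT t₁ t₂ s₁)
      (fBmKernel_nonneg t₁ t₂ s₁) intervalIntegrable_const
      (fun s₂ hs₂ => le_fBmKernel hr hr0 ht hs₁ hs₂)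
    simpa only [fBmKernelInt₁, intervalIntegral.integral_const, sub_sub_cancel, one_smul] using h
  have h := integral_le_integral_of_subinterval ht₁ (by linarith : t₁ ≤ t₁ + 1)
    (by linarith : t₁ + 1 ≤ T) (intervalIntegrable_fBmKernelInt₁ hr1 hT t₁ t₂)
    (fBmKernelInt₁_nonneg hT t₁ t₂) intervalIntegrable_const hint₁
  simpa only [fBmKernelInt₂, intervalIntegral.integral_const, add_sub_cancel_left, one_smul] using h

theorem le_fBmKernelInt₃ (hr : -1 / 2 ≤ r) (hr0 : r ≤ 0) (hT : 6 ≤ T) {t₁ : ℝ}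
    (ht₁ : t₁ ∈ Set.Icc 0 (T / 2)) :
    Real.exp (-2) * Real.log (T / 6) ≤ fBmKernelInt₃ r T t₁ := by
  obtain ⟨h1, h2⟩ := ht₁
  have hI : IntervalIntegrable (fun t₂ : ℝ => Real.exp (-2) * (t₂ - t₁)⁻¹) volume (t₁ + 3) T := by
    refine ContinuousOn.intervalIntegrable ?_
    rw [Set.uIcc_of_le (by linarith)]
    refine continuousOn_const.mul (ContinuousOn.inv₀ (by fun_prop) fun t₂ ht₂ => ?_)
    linarith [ht₂.1]
  have h := integral_le_integral_of_subinterval (by linarith : 0 ≤ t₁ + 3)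
    (by linarith : t₁ + 3 ≤ T) le_rfl
    (intervalIntegrable_fBmKernelInt₂ (by linarith : -1 < r) (by linarith) t₁)
    (fBmKernelInt₂_nonneg (by linarith) t₁) hI
    (fun t₂ ht₂ => le_fBmKernelInt₂ hr hr0 h1 ht₂.1 ht₂.2)
  refine le_trans ?_ h
  rw [intervalIntegral.integral_const_mul,
    intervalIntegral.integral_comp_sub_right (fun u : ℝ => u⁻¹) t₁,
    integral_inv_of_pos (by linarith) (by linarith)]
  refine mul_le_mul_of_nonneg_left (Real.log_le_log (by linarith) ?_) (by positivity)
  rw [add_sub_cancel_left]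
  linarith

theorem le_integral_fBmKernelInt₃ (hr : -1 / 2 ≤ r) (hr0 : r ≤ 0) (hT : 6 ≤ T) :
    T / 2 * (Real.exp (-2) * Real.log (T / 6)) ≤ ∫ t₁ in (0:ℝ)..T, fBmKernelInt₃ r T t₁ := by
  have h := integral_le_integral_of_subinterval (le_refl (0:ℝ)) (by linarith : 0 ≤ T / 2)
    (by linarith : T / 2 ≤ T)
    (intervalIntegrable_fBmKernelInt₃ (by linarith : -1 < r) (by linarith))
    (fBmKernelInt₃_nonneg (by linarith)) intervalIntegrable_const
    (fun t₁ ht₁ => le_fBmKernelInt₃ hr hr0 hT ht₁)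
  simpa only [intervalIntegral.integral_const, sub_zero, smul_eq_mul] using h

end

theorem stmt_5 (H : ℝ) (hH : H ∈ Set.Ico (3/4 : ℝ) 1) :
    Tendsto (fun T : ℝ => fBmNormSq H T / (2 * T)) atTop atTop ∧
      ∀ L : ℝ, ¬ Tendsto (fun T : ℝ => fBmNormSq H T / (2 * T)) atTop (nhds L) := by
  obtain ⟨h1, h2⟩ := hH
  have hc : 0 < H ^ 2 * (2 * H - 1) ^ 2 := by
    have : 0 < 2 * H - 1 := by linarith
    positivity
  have hmain : Tendsto (fun T : ℝ => fBmNormSq H T / (2 * T)) atTop atTop := by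
    have hlog : Tendsto (fun T : ℝ => H ^ 2 * (2 * H - 1) ^ 2 * Real.exp (-2) / 4 *
        Real.log (T / 6)) atTop atTop :=
      (Real.tendsto_log_atTop.comp (tendsto_id.atTop_div_const (by norm_num))).const_mul_atTop
        (by positivity)
    refine tendsto_atTop_mono' _ ?_ hlog
    filter_upwards [eventually_ge_atTop (6:ℝ)] with T hT
    have h := le_integral_fBmKernelInt₃ (r := 2 * H - 2) (by linarith) (by linarith) hT
    have hN : fBmNormSq H T =
        H ^ 2 * (2 * H - 1) ^ 2 * ∫ t₁ in (0:ℝ)..T, fBmKernelInt₃ (2 * H - 2) T t₁ := rfl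
    rw [hN, le_div_iff₀ (by linarith)]
    calc _ = H ^ 2 * (2 * H - 1) ^ 2 * (T / 2 * (Real.exp (-2) * Real.log (T / 6))) := by ring
      _ ≤ _ := mul_le_mul_of_nonneg_left h hc.le
  exact ⟨hmain, fun L => not_tendsto_nhds_of_tendsto_atTop hmain L⟩
end

section
/- Let H ∈ (1/2, 3/4). Then there exists a positive constant C, independent of T, such that for all T ≥ 1, |N(T)/(2T) − σ²| ≤ C·T^{4H−3}, where σ² = H²Γ(2H)²(4H−1)(1 − 1/cos(2Hπ)). (Note that min(1, 3−4H) = 3−4H for H in this range.) -/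
open Real MeasureTheory intervalIntegral

namespace FBmNorm

open Set
open scoped ENNReal

section OneDimensional

/-- The `ℝ≥0∞`-valued Laplace kernel `e^{-|x|}`. -/
noncomputable def expKer (x : ℝ) : ℝ≥0∞ := ENNReal.ofReal (exp (-|x|))

/-- The `ℝ≥0∞`-valued Riesz kernel `|x|^b`. -/
noncomputable def rieszKer (b x : ℝ) : ℝ≥0∞ := ENNReal.ofReal (|x| ^ b)

@[fun_prop]
lemma measurable_expKer : Measurable expKer := by unfold expKer; fun_prop

@[fun_prop]
lemma measurable_rieszKer (b : ℝ) : Measurable (rieszKer b) := by unfold rieszKer; fun_prop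

lemma even_expKer : expKer.Even := fun x ↦ by simp [expKer]

lemma even_rieszKer (b : ℝ) : (rieszKer b).Even := fun x ↦ by simp [rieszKer]

lemma lintegral_comp_abs (f : ℝ → ℝ≥0∞) :
    ∫⁻ x, f |x| = 2 * ∫⁻ x in Ioi 0, f x := by
  have h₁ : ∫⁻ x in Ioi 0, f |x| = ∫⁻ x in Ioi 0, f x :=
    setLIntegral_congr_fun measurableSet_Ioi fun x hx ↦ by rw [abs_of_pos hx]
  have h₂ : ∫⁻ x in Iic 0, f |x| = ∫⁻ x in Ioi 0, f x := by
    rw [← h₁, ← lintegral_indicator measurableSet_Iic, ← lintegral_neg_eq_self,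
      setLIntegral_congr Ioi_ae_eq_Ici, ← lintegral_indicator measurableSet_Ici]
    congr with x
    simp [indicator]
  rw [← lintegral_add_compl _ (measurableSet_Iic (a := (0 : ℝ))), compl_Iic, h₁, h₂, two_mul]

lemma setLIntegral_rpow_Ioc {b r : ℝ} (hb : -1 < b) (hr : 0 ≤ r) :
    ∫⁻ x in Ioc 0 r, ENNReal.ofReal (x ^ b) = ENNReal.ofReal (r ^ (b + 1) / (b + 1)) := by
  have hi := (intervalIntegral.intervalIntegrable_rpow' (a := 0) (b := r) hb)
  rw [intervalIntegrable_iff_integrableOn_Ioc_of_le hr] at hi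
  rw [← ofReal_integral_eq_lintegral_ofReal hi
    (ae_restrict_of_forall_mem measurableSet_Ioc fun x hx ↦ rpow_nonneg hx.1.le _),
    ← intervalIntegral.integral_of_le hr, integral_rpow (Or.inl hb),
    zero_rpow (by linarith), sub_zero]

lemma setLIntegral_rpow_Ioi {b r : ℝ} (hb : b < -1) (hr : 0 < r) :
    ∫⁻ x in Ioi r, ENNReal.ofReal (x ^ b) = ENNReal.ofReal (-r ^ (b + 1) / (b + 1)) := by
  rw [← ofReal_integral_eq_lintegral_ofReal (integrableOn_Ioi_rpow_of_lt hb hr)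
    (ae_restrict_of_forall_mem measurableSet_Ioi fun x hx ↦
      rpow_nonneg (hr.trans hx).le _), integral_Ioi_rpow_of_lt hb hr]

lemma setLIntegral_exp_mul_rpow {s : ℝ} (hs : 0 < s) :
    ∫⁻ x in Ioi 0, ENNReal.ofReal (exp (-x) * x ^ (s - 1)) = ENNReal.ofReal (Gamma s) := by
  rw [← ofReal_integral_eq_lintegral_ofReal (GammaIntegral_convergent hs)
    (ae_restrict_of_forall_mem measurableSet_Ioi fun x hx ↦
      mul_nonneg (exp_pos _).le (rpow_nonneg (le_of_lt hx) _)), Gamma_eq_integral hs]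

lemma setLIntegral_beta {α β : ℝ} (hα : 0 < α) (hβ : 0 < β) :
    ∫⁻ x in Ioo 0 1, ENNReal.ofReal (x ^ (α - 1) * (1 - x) ^ (β - 1)) =
      ENNReal.ofReal (ProbabilityTheory.beta α β) := by
  have hpos := ProbabilityTheory.beta_pos hα hβ
  have h := ProbabilityTheory.lintegral_betaPDF_eq_one hα hβ
  rw [ProbabilityTheory.lintegral_betaPDF] at h
  simp_rw [mul_assoc, ENNReal.ofReal_mul (one_div_pos.2 hpos).le] at h
  rw [lintegral_const_mul' _ _ ENNReal.ofReal_ne_top] at h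
  rw [← mul_one (ENNReal.ofReal (ProbabilityTheory.beta α β)), ← h, ← mul_assoc,
    ← ENNReal.ofReal_mul hpos.le, mul_one_div_cancel hpos.ne', ENNReal.ofReal_one, one_mul]

lemma lintegral_expKer : ∫⁻ x, expKer x = 2 := by
  unfold expKer
  rw [lintegral_comp_abs fun x ↦ ENNReal.ofReal (exp (-x))]
  have h := setLIntegral_exp_mul_rpow one_pos
  simp only [sub_self, rpow_zero, mul_one, Gamma_one, ENNReal.ofReal_one] at h
  rw [h, mul_one]

lemma rieszKer_mul_self (b x : ℝ) : rieszKer b x * rieszKer b x = rieszKer (2 * b) x := by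
  rw [rieszKer, ← ENNReal.ofReal_mul (by positivity), rieszKer, mul_comm 2 b,
    rpow_mul (abs_nonneg x), rpow_two, sq]

lemma lintegral_rieszKer_mul_min {b T : ℝ} (hb : -2 < b) (hb' : b < -1) (hT : 0 < T) :
    ∫⁻ w, rieszKer b w * ENNReal.ofReal (min |w| T) =
      ENNReal.ofReal (2 * (1 / (b + 2) - 1 / (b + 1)) * T ^ (b + 2)) := by
  unfold rieszKer
  rw [lintegral_comp_abs fun w ↦ ENNReal.ofReal (w ^ b) * ENNReal.ofReal (min w T),
    ← Ioc_union_Ioi_eq_Ioi hT.le, lintegral_union measurableSet_Ioi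
      (Ioc_disjoint_Ioi le_rfl)]
  have h₁ : ∫⁻ w in Ioc 0 T, ENNReal.ofReal (w ^ b) * ENNReal.ofReal (min w T) =
      ENNReal.ofReal (T ^ (b + 2) / (b + 2)) := by
    rw [show b + 2 = (b + 1) + 1 by ring, ← setLIntegral_rpow_Ioc (by linarith) hT.le]
    refine setLIntegral_congr_fun measurableSet_Ioc fun w hw ↦ ?_
    rw [min_eq_left hw.2, ← ENNReal.ofReal_mul (rpow_nonneg hw.1.le _), rpow_add_one hw.1.ne']
  have h₂ : ∫⁻ w in Ioi T, ENNReal.ofReal (w ^ b) * ENNReal.ofReal (min w T) =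
      ENNReal.ofReal (-(T ^ (b + 2) / (b + 1))) := by
    have : ∫⁻ w in Ioi T, ENNReal.ofReal (w ^ b) * ENNReal.ofReal (min w T) =
        ∫⁻ w in Ioi T, ENNReal.ofReal (w ^ b) * ENNReal.ofReal T :=
      setLIntegral_congr_fun measurableSet_Ioi fun w hw ↦ by
        simp only [min_eq_right (le_of_lt (mem_Ioi.1 hw))]
    rw [this, lintegral_mul_const' _ _ ENNReal.ofReal_ne_top, setLIntegral_rpow_Ioi hb' hT,
      ← ENNReal.ofReal_mul', show b + 2 = (b + 1) + 1 by ring, rpow_add_one hT.ne' (b + 1)]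
    · congr 1; ring
    · exact hT.le
  have hTb := rpow_pos_of_pos hT (b + 2)
  have e₁ : 0 ≤ T ^ (b + 2) / (b + 2) := div_nonneg hTb.le (by linarith)
  have e₂ : 0 ≤ -(T ^ (b + 2) / (b + 1)) := by
    rw [← div_neg]; exact div_nonneg hTb.le (by linarith)
  rw [h₁, h₂, ← ENNReal.ofReal_add e₁ e₂, ← ENNReal.ofReal_ofNat, ← ENNReal.ofReal_mul (by simp)]
  congr 1; ring

end OneDimensional

section Convolution

lemma even_lconvolution {f g : ℝ → ℝ≥0∞} (hf : f.Even) (hg : g.Even) : (f ⋆ₗ g).Even := by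
  intro x
  rw [lconvolution_def, lconvolution_def, ← lintegral_neg_eq_self]
  refine lintegral_congr fun y ↦ ?_
  rw [hf, ← hg]
  congr 2; ring

lemma lintegral_mul_sub_sub (f g : ℝ → ℝ≥0∞) (x y : ℝ) :
    ∫⁻ s, f (x - s) * g (s - y) = (f ⋆ₗ g) (x - y) := by
  rw [lconvolution_def, ← lintegral_sub_left_eq_self _ x]
  refine lintegral_congr fun s ↦ ?_
  congr 2 <;> ring

lemma expKer_lconvolution_rieszKer_le {b w : ℝ} (hb : -1 < b) (hb' : b < 0) (hw : w ≠ 0) :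
    (expKer ⋆ₗ rieszKer b) w ≤ ENNReal.ofReal (2 ^ (-b) * (2 + 2 / (b + 1))) * rieszKer b w := by
  set r := |w| / 2 with hr
  have hr0 : 0 < r := by positivity
  have hb1 : 0 < b + 1 := by linarith
  have key : ∀ y, expKer y * rieszKer b (-y + w) ≤ expKer y * ENNReal.ofReal (r ^ b) +
      ENNReal.ofReal (exp (-r)) *
        (fun z ↦ (Ioc 0 r).indicator (fun x ↦ ENNReal.ofReal (x ^ b)) |z|) (w - y) := by
    intro y
    rw [show -y + w = w - y by ring]
    by_cases h : r < |w - y|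
    · refine le_add_right (mul_le_mul_right (ENNReal.ofReal_le_ofReal ?_) _)
      exact rpow_le_rpow_of_nonpos hr0 h.le hb'.le
    · push Not at h
      rcases eq_or_ne (w - y) 0 with h0 | h0
      · simp [rieszKer, h0, zero_rpow hb'.ne]
      refine le_add_left ?_
      simp only
      rw [indicator_of_mem (show |w - y| ∈ Ioc 0 r from ⟨abs_pos.2 h0, h⟩)]
      refine mul_le_mul_left (ENNReal.ofReal_le_ofReal (exp_le_exp.2 ?_)) _
      have := abs_sub_abs_le_abs_sub w y
      linarith
  have hm : Measurable fun z : ℝ ↦ (Ioc 0 r).indicator (fun x ↦ ENNReal.ofReal (x ^ b)) |z| := by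
    have : Measurable ((Ioc 0 r).indicator (fun x ↦ ENNReal.ofReal (x ^ b))) :=
      Measurable.indicator (by fun_prop) measurableSet_Ioc
    fun_prop
  have hx : r * exp (-r) ≤ 1 := by
    rw [exp_neg, ← div_eq_mul_inv, div_le_one (exp_pos _)]
    linarith [add_one_le_exp r]
  calc (expKer ⋆ₗ rieszKer b) w
      ≤ ∫⁻ y, (expKer y * ENNReal.ofReal (r ^ b) + ENNReal.ofReal (exp (-r)) *
        (fun z ↦ (Ioc 0 r).indicator (fun x ↦ ENNReal.ofReal (x ^ b)) |z|) (w - y)) :=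
        lintegral_mono key
    _ = 2 * ENNReal.ofReal (r ^ b) +
          ENNReal.ofReal (exp (-r)) * (2 * ENNReal.ofReal (r ^ (b + 1) / (b + 1))) := by
        rw [lintegral_add_left (by fun_prop), lintegral_mul_const' _ _ ENNReal.ofReal_ne_top,
          lintegral_const_mul' _ _ ENNReal.ofReal_ne_top, lintegral_expKer,
          lintegral_sub_left_eq_self
            (fun z ↦ (Ioc 0 r).indicator (fun x ↦ ENNReal.ofReal (x ^ b)) |z|) w,
          lintegral_comp_abs, ← setLIntegral_rpow_Ioc hb hr0.le,
          setLIntegral_indicator measurableSet_Ioc, inter_eq_left.2 Ioc_subset_Ioi_self]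
    _ = ENNReal.ofReal (r ^ b * (2 + 2 * (r * exp (-r)) / (b + 1))) := by
        rw [← ENNReal.ofReal_ofNat, ← ENNReal.ofReal_mul (by simp), ← ENNReal.ofReal_mul (by simp),
          ← ENNReal.ofReal_mul (by positivity), ← ENNReal.ofReal_add (by positivity)
            (by positivity), rpow_add_one hr0.ne']
        congr 1; ring
    _ ≤ ENNReal.ofReal (r ^ b * (2 + 2 * 1 / (b + 1))) := by gcongr
    _ = _ := by
        rw [rieszKer, ← ENNReal.ofReal_mul (by positivity), hr,
          div_rpow (abs_nonneg w) (by simp), rpow_neg (by simp)]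
        congr 1; ring

lemma expKer_lconvolution_expKer (w : ℝ) :
    (expKer ⋆ₗ expKer) w = ENNReal.ofReal ((1 + |w|) * exp (-|w|)) := by
  wlog hw : 0 ≤ w generalizing w
  · rw [← even_lconvolution even_expKer even_expKer, this (-w) (by linarith), abs_neg]
  have h₁ : ∫⁻ y in Iic 0, expKer y * expKer (-y + w) = ENNReal.ofReal (exp (-w) / 2) := by
    have : ∫⁻ y in Iic 0, expKer y * expKer (-y + w) =
        ∫⁻ y in Iic 0, ENNReal.ofReal (exp (-w)) * ENNReal.ofReal (exp (2 * y)) := by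
      refine setLIntegral_congr_fun measurableSet_Iic fun y (hy : y ≤ 0) ↦ ?_
      simp only [expKer]
      rw [← ENNReal.ofReal_mul (exp_pos _).le, ← ENNReal.ofReal_mul (exp_pos _).le, ← exp_add,
        ← exp_add, abs_of_nonpos hy, abs_of_nonneg (by linarith)]
      congr 2; ring
    rw [this, lintegral_const_mul' _ _ ENNReal.ofReal_ne_top,
      ← ofReal_integral_eq_lintegral_ofReal (integrableOn_exp_mul_Iic two_pos 0)
        (.of_forall fun _ ↦ (exp_pos _).le), integral_exp_mul_Iic two_pos,
      ← ENNReal.ofReal_mul (exp_pos _).le]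
    simp [div_eq_mul_inv]
  have h₂ : ∫⁻ y in Ioc 0 w, expKer y * expKer (-y + w) = ENNReal.ofReal (w * exp (-w)) := by
    have : ∫⁻ y in Ioc 0 w, expKer y * expKer (-y + w) =
        ∫⁻ y in Ioc 0 w, ENNReal.ofReal (exp (-w)) := by
      refine setLIntegral_congr_fun measurableSet_Ioc fun y hy ↦ ?_
      simp only [expKer]
      rw [← ENNReal.ofReal_mul (exp_pos _).le, ← exp_add, abs_of_nonneg hy.1.le,
        abs_of_nonneg (by linarith [hy.2])]
      congr 2; ring
    rw [this, setLIntegral_const, volume_Ioc, sub_zero, ← ENNReal.ofReal_mul (exp_pos _).le,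
      mul_comm]
  have h₃ : ∫⁻ y in Ioi w, expKer y * expKer (-y + w) = ENNReal.ofReal (exp (-w) / 2) := by
    have : ∫⁻ y in Ioi w, expKer y * expKer (-y + w) =
        ∫⁻ y in Ioi w, ENNReal.ofReal (exp w) * ENNReal.ofReal (exp (-2 * y)) := by
      refine setLIntegral_congr_fun measurableSet_Ioi fun y (hy : w < y) ↦ ?_
      simp only [expKer]
      rw [← ENNReal.ofReal_mul (exp_pos _).le, ← ENNReal.ofReal_mul (exp_pos _).le, ← exp_add,
        ← exp_add, abs_of_nonneg (hw.trans hy.le), abs_of_nonpos (by linarith)]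
      congr 2; ring
    rw [this, lintegral_const_mul' _ _ ENNReal.ofReal_ne_top,
      ← ofReal_integral_eq_lintegral_ofReal (integrableOn_exp_mul_Ioi (by norm_num) w)
        (.of_forall fun _ ↦ (exp_pos _).le), integral_exp_mul_Ioi (by norm_num),
      ← ENNReal.ofReal_mul (exp_pos _).le, neg_div_neg_eq, ← mul_div_assoc, ← exp_add]
    congr 3; ring
  rw [lconvolution_def, ← lintegral_add_compl _ (measurableSet_Iic (a := (0 : ℝ))), compl_Iic,
    ← Ioc_union_Ioi_eq_Ioi hw, lintegral_union measurableSet_Ioi (Ioc_disjoint_Ioi le_rfl),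
    h₁, h₂, h₃, ← ENNReal.ofReal_add (by positivity) (by positivity),
    ← ENNReal.ofReal_add (by positivity) (by positivity), abs_of_nonneg hw]
  congr 1; ring

lemma rieszKer_lconvolution_self_one {a : ℝ} (ha : -1 < a) (ha' : a < -1 / 2) :
    (rieszKer a ⋆ₗ rieszKer a) 1 = ENNReal.ofReal (ProbabilityTheory.beta (a + 1) (a + 1) +
      2 * ProbabilityTheory.beta (-2 * a - 1) (a + 1)) := by
  have h₂ : ∫⁻ y in Ioo 0 1, rieszKer a y * rieszKer a (-y + 1) =
      ENNReal.ofReal (ProbabilityTheory.beta (a + 1) (a + 1)) := by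
    rw [← setLIntegral_beta (by linarith) (by linarith)]
    refine setLIntegral_congr_fun measurableSet_Ioo fun y hy ↦ ?_
    have : 0 ≤ y ^ a := rpow_nonneg hy.1.le a
    simp only [rieszKer]
    rw [abs_of_pos hy.1, abs_of_pos (by linarith [hy.2]), ← ENNReal.ofReal_mul this,
      add_sub_cancel_right, neg_add_eq_sub]
  have h₃ : ∫⁻ y in Ioi 1, rieszKer a y * rieszKer a (-y + 1) =
      ENNReal.ofReal (ProbabilityTheory.beta (-2 * a - 1) (a + 1)) := by
    rw [← setLIntegral_beta (by linarith) (by linarith)]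
    have himg : (fun x : ℝ ↦ x⁻¹) '' Ioo 0 1 = Ioi 1 := by
      rw [image_inv_eq_inv, inv_Ioo_0_left one_pos, inv_one]
    rw [← himg, lintegral_image_eq_lintegral_abs_deriv_mul measurableSet_Ioo
      (fun x hx ↦ (hasDerivAt_inv hx.1.ne').hasDerivWithinAt) inv_injective.injOn]
    refine setLIntegral_congr_fun measurableSet_Ioo fun y hy ↦ ?_
    have hy0 := hy.1
    have hy1 : 0 < 1 - y := by linarith [hy.2]
    simp only [rieszKer]
    have e : -y⁻¹ + 1 = -((1 - y) * y⁻¹) := by field_simp; ring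
    rw [e, abs_neg, abs_neg, abs_of_pos (by positivity), abs_of_pos (by positivity),
      abs_of_pos (by positivity), ← ENNReal.ofReal_mul (by positivity),
      ← ENNReal.ofReal_mul (by positivity), add_sub_cancel_right,
      mul_rpow hy1.le (by positivity), inv_rpow hy0.le, ← rpow_neg hy0.le,
      ← rpow_natCast, ← rpow_neg hy0.le]
    congr 1
    rw [show -2 * a - 1 - 1 = -((2 : ℕ) : ℝ) + -a + -a by push_cast; ring, rpow_add hy0,
      rpow_add hy0]
    ring
  have h₁ : ∫⁻ y in Iic 0, rieszKer a y * rieszKer a (-y + 1) =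
      ENNReal.ofReal (ProbabilityTheory.beta (-2 * a - 1) (a + 1)) := by
    rw [← h₃, setLIntegral_congr Ioi_ae_eq_Ici, ← lintegral_indicator measurableSet_Iic,
      ← lintegral_indicator measurableSet_Ici, ← lintegral_sub_left_eq_self _ (1 : ℝ)]
    refine lintegral_congr fun y ↦ ?_
    simp only [indicator, mem_Iic, mem_Ici, sub_nonpos]
    congr 1
    rw [mul_comm]
    congr 2 <;> ring
  have hB := ProbabilityTheory.beta_pos (α := -2 * a - 1) (β := a + 1) (by linarith) (by linarith)
  have hB' := ProbabilityTheory.beta_pos (α := a + 1) (β := a + 1) (by linarith) (by linarith)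
  rw [lconvolution_def, ← lintegral_add_compl _ (measurableSet_Iic (a := (0 : ℝ))), compl_Iic,
    ← Ioc_union_Ioi_eq_Ioi zero_le_one, lintegral_union measurableSet_Ioi
    (Ioc_disjoint_Ioi le_rfl), ← setLIntegral_congr Ioo_ae_eq_Ioc, h₁, h₂, h₃,
    ← ENNReal.ofReal_add hB'.le hB.le, ← ENNReal.ofReal_add hB.le (by linarith)]
  congr 1; ring

lemma rieszKer_lconvolution_self {a w : ℝ} (hw : w ≠ 0) :
    (rieszKer a ⋆ₗ rieszKer a) w = (rieszKer a ⋆ₗ rieszKer a) 1 * rieszKer (2 * a + 1) w := by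
  wlog h : 0 < w generalizing w
  · have h' : w < 0 := lt_of_le_of_ne (not_lt.1 h) hw
    rw [← even_lconvolution (even_rieszKer a) (even_rieszKer a),
      this (neg_ne_zero.2 hw) (by linarith), even_rieszKer]
  conv_lhs =>
    rw [lconvolution_def, ← Real.smul_map_volume_mul_left hw, lintegral_smul_measure,
      lintegral_map (by fun_prop) (by fun_prop)]
  have : ∀ u, rieszKer a (w * u) * rieszKer a (-(w * u) + w) =
      ENNReal.ofReal (w ^ (2 * a)) * (rieszKer a u * rieszKer a (-u + 1)) := by
    intro u
    simp only [rieszKer]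
    rw [show -(w * u) + w = w * (-u + 1) by ring, abs_mul, abs_mul, abs_of_pos h,
      mul_rpow h.le (abs_nonneg _), mul_rpow h.le (abs_nonneg _), two_mul, rpow_add h,
      ENNReal.ofReal_mul (by positivity), ENNReal.ofReal_mul (by positivity),
      ENNReal.ofReal_mul (by positivity)]
    ring
  simp_rw [this]
  rw [lintegral_const_mul' _ _ ENNReal.ofReal_ne_top, smul_eq_mul, ← mul_assoc,
    ← ENNReal.ofReal_mul (abs_nonneg w), mul_comm, rieszKer, rpow_add_one (by simpa), mul_comm |w|,
    abs_of_pos h, lconvolution_def]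

end Convolution

section CyclicIntegral

lemma setLIntegral_setLIntegral_compl_le {φ : ℝ → ℝ≥0∞} (hφ : Measurable φ) (T : ℝ) :
    ∫⁻ t in Ioc 0 T, ∫⁻ s in (Ioc 0 T)ᶜ, φ (t - s) ≤ ∫⁻ w, φ w * ENNReal.ofReal (min |w| T) := by
  have hA : MeasurableSet (Ioc 0 T)ᶜ := measurableSet_Ioc.compl
  have h₁ : ∀ t, ∫⁻ s in (Ioc 0 T)ᶜ, φ (t - s) =
      ∫⁻ w, φ w * (Ioc 0 T)ᶜ.indicator 1 (t - w) := by
    intro t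
    rw [← lintegral_indicator hA, ← lintegral_sub_left_eq_self _ t]
    refine lintegral_congr fun w ↦ ?_
    by_cases h : t - w ∈ (Ioc 0 T)ᶜ <;> simp [indicator, h]
  have hm : Measurable ((Ioc 0 T)ᶜ.indicator (1 : ℝ → ℝ≥0∞)) := measurable_one.indicator hA
  simp_rw [h₁]
  rw [lintegral_lintegral_swap (by fun_prop)]
  refine lintegral_mono fun w ↦ ?_
  rw [lintegral_const_mul _ (by fun_prop)]
  refine mul_le_mul_right ?_ _
  have h₂ : ∫⁻ t in Ioc 0 T, (Ioc 0 T)ᶜ.indicator (1 : ℝ → ℝ≥0∞) (t - w) =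
      volume ({t | t - w ∈ (Ioc 0 T)ᶜ} ∩ Ioc 0 T) := by
    have hS : MeasurableSet {t | t - w ∈ (Ioc 0 T)ᶜ} := (measurable_sub_const w) hA
    rw [← Measure.restrict_apply hS, ← lintegral_indicator_one hS]
    rfl
  rw [h₂, ENNReal.ofReal_min]
  refine le_min ?_ ((measure_mono inter_subset_right).trans (by simp))
  rcases le_total 0 w with h | h
  · refine (measure_mono (t := Ioc 0 w) ?_).trans (by simp [abs_of_nonneg h])
    rintro t ⟨ht, ht', ht''⟩
    refine ⟨ht', not_lt.1 fun hc ↦ ht ⟨by linarith, by linarith⟩⟩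
  · refine (measure_mono (t := Ioc (T + w) T) ?_).trans (by simp [abs_of_nonpos h])
    rintro t ⟨ht, ht', ht''⟩
    refine ⟨not_le.1 fun hc ↦ ht ⟨by linarith, by linarith⟩, ht''⟩

/-- The cyclic product of kernels along `t₁ → s₁ → s₂ → t₂ → t₁`. -/
noncomputable def cyclicKer (e p : ℝ → ℝ≥0∞) (t₁ t₂ s₁ s₂ : ℝ) : ℝ≥0∞ :=
  e (t₁ - s₁) * e (t₂ - s₂) * p (t₂ - t₁) * p (s₁ - s₂)

variable {e p : ℝ → ℝ≥0∞}

@[fun_prop]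
lemma measurable_cyclicKer (he : Measurable e) (hp : Measurable p) {α : Type*}
    [MeasurableSpace α] {f₁ f₂ f₃ f₄ : α → ℝ} (h₁ : Measurable f₁) (h₂ : Measurable f₂)
    (h₃ : Measurable f₃) (h₄ : Measurable f₄) :
    Measurable fun x ↦ cyclicKer e p (f₁ x) (f₂ x) (f₃ x) (f₄ x) := by
  unfold cyclicKer; fun_prop

lemma lintegral_cyclicKer_s₁ (he : Measurable e) (hp : Measurable p) (t₁ t₂ s₂ : ℝ) :
    ∫⁻ s₁, cyclicKer e p t₁ t₂ s₁ s₂ =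
      (e ⋆ₗ p) (t₁ - s₂) * (e (t₂ - s₂) * p (t₂ - t₁)) := by
  rw [← lintegral_mul_sub_sub, ← lintegral_mul_const _ (by fun_prop)]
  exact lintegral_congr fun s₁ ↦ by unfold cyclicKer; ring

lemma lintegral_cyclicKer_s₂ (he : Measurable e) (hp : Measurable p) (he' : e.Even)
    (t₁ t₂ s₁ : ℝ) :
    ∫⁻ s₂, cyclicKer e p t₁ t₂ s₁ s₂ =
      e (t₁ - s₁) * p (t₂ - t₁) * (p ⋆ₗ e) (s₁ - t₂) := by
  rw [← lintegral_mul_sub_sub, ← lintegral_const_mul _ (by fun_prop)]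
  refine lintegral_congr fun s₂ ↦ ?_
  rw [cyclicKer, ← he' (t₂ - s₂), neg_sub]
  ring

lemma lintegral_cyclicKer_s₁_s₂ (he : Measurable e) (hp : Measurable p) (he' : e.Even)
    (hp' : p.Even) (t₁ t₂ : ℝ) :
    ∫⁻ s₁, ∫⁻ s₂, cyclicKer e p t₁ t₂ s₁ s₂ = p (t₁ - t₂) * (e ⋆ₗ p ⋆ₗ e) (t₁ - t₂) := by
  simp_rw [lintegral_cyclicKer_s₂ he hp he']
  rw [← lintegral_mul_sub_sub, ← lintegral_const_mul _ (by fun_prop), ← hp', neg_sub]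
  exact lintegral_congr fun s₁ ↦ by ring

lemma lintegral_cyclicKer_t₂_s₂ (he : Measurable e) (hp : Measurable p) (he' : e.Even)
    (hp' : p.Even) (t₁ s₁ : ℝ) :
    ∫⁻ t₂, ∫⁻ s₂, cyclicKer e p t₁ t₂ s₁ s₂ = e (t₁ - s₁) * ((p ⋆ₗ e) ⋆ₗ p) (t₁ - s₁) := by
  simp_rw [lintegral_cyclicKer_s₂ he hp he']
  rw [← even_lconvolution (even_lconvolution hp' he') hp', neg_sub, ← lintegral_mul_sub_sub,
    ← lintegral_const_mul _ (by fun_prop)]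
  exact lintegral_congr fun s₁ ↦ by ring

lemma lintegral_cyclicKer_t₂_s₁ (he : Measurable e) (hp : Measurable p) (he' : e.Even)
    (hp' : p.Even) (t₁ s₂ : ℝ) :
    ∫⁻ t₂, ∫⁻ s₁, cyclicKer e p t₁ t₂ s₁ s₂ = (e ⋆ₗ p) (t₁ - s₂) * (e ⋆ₗ p) (t₁ - s₂) := by
  simp_rw [lintegral_cyclicKer_s₁ he hp]
  rw [lintegral_const_mul _ (by fun_prop)]
  congr 1
  rw [← even_lconvolution he' hp', neg_sub, ← lintegral_mul_sub_sub]
  refine lintegral_congr fun t₂ ↦ ?_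
  rw [← he' (t₂ - s₂), neg_sub]

lemma lintegral_cyclicKer (he : Measurable e) (hp : Measurable p) (he' : e.Even)
    (hp' : p.Even) (t₁ : ℝ) :
    ∫⁻ t₂, ∫⁻ s₁, ∫⁻ s₂, cyclicKer e p t₁ t₂ s₁ s₂ =
      ∫⁻ w, (e ⋆ₗ e) w * (p ⋆ₗ p) w := by
  simp_rw [lintegral_cyclicKer_s₁_s₂ he hp he' hp']
  rw [lintegral_sub_left_eq_self fun w ↦ p w * (e ⋆ₗ p ⋆ₗ e) w]
  have h : ∀ f g : ℝ → ℝ≥0∞, g.Even → ∫⁻ w, f w * g w = (f ⋆ₗ g) 0 := by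
    intro f g hg
    rw [lconvolution_def]
    refine lintegral_congr fun w ↦ ?_
    rw [add_zero, hg]
  rw [h _ _ (even_lconvolution he' (even_lconvolution hp' he')),
    h _ _ (even_lconvolution hp' hp'), lconvolution_comm (f := p) (g := e),
    lconvolution_assoc he he hp, lconvolution_comm (f := p),
    ← lconvolution_assoc (by fun_prop) hp hp]

lemma lintegral_cyclicKer_le (he : Measurable e) (hp : Measurable p) (he' : e.Even)
    (hp' : p.Even) (T : ℝ) :
    ENNReal.ofReal T * ∫⁻ w, (e ⋆ₗ e) w * (p ⋆ₗ p) w ≤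
      (∫⁻ w, p w * (e ⋆ₗ p ⋆ₗ e) w * ENNReal.ofReal (min |w| T)) +
      (∫⁻ w, e w * ((p ⋆ₗ e) ⋆ₗ p) w * ENNReal.ofReal (min |w| T)) +
      (∫⁻ w, (e ⋆ₗ p) w * (e ⋆ₗ p) w * ENNReal.ofReal (min |w| T)) +
      ∫⁻ t₁ in Ioc 0 T, ∫⁻ t₂ in Ioc 0 T, ∫⁻ s₁ in Ioc 0 T, ∫⁻ s₂ in Ioc 0 T,
        cyclicKer e p t₁ t₂ s₁ s₂ := by
  set A := Ioc (0 : ℝ) T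
  have hA : MeasurableSet A := measurableSet_Ioc
  have h₁ : ∫⁻ t₁ in A, ∫⁻ t₂ in Aᶜ, ∫⁻ s₁, ∫⁻ s₂, cyclicKer e p t₁ t₂ s₁ s₂ ≤
      ∫⁻ w, p w * (e ⋆ₗ p ⋆ₗ e) w * ENNReal.ofReal (min |w| T) := by
    simp_rw [lintegral_cyclicKer_s₁_s₂ he hp he' hp']
    exact setLIntegral_setLIntegral_compl_le (by fun_prop) T
  have h₂ : ∫⁻ t₁ in A, ∫⁻ t₂, ∫⁻ s₁ in Aᶜ, ∫⁻ s₂, cyclicKer e p t₁ t₂ s₁ s₂ ≤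
      ∫⁻ w, e w * ((p ⋆ₗ e) ⋆ₗ p) w * ENNReal.ofReal (min |w| T) := by
    have : ∀ t₁, ∫⁻ t₂, ∫⁻ s₁ in Aᶜ, ∫⁻ s₂, cyclicKer e p t₁ t₂ s₁ s₂ =
        ∫⁻ s₁ in Aᶜ, ∫⁻ t₂, ∫⁻ s₂, cyclicKer e p t₁ t₂ s₁ s₂ := fun t₁ ↦
      lintegral_lintegral_swap (by fun_prop)
    simp_rw [this, lintegral_cyclicKer_t₂_s₂ he hp he' hp']
    exact setLIntegral_setLIntegral_compl_le (by fun_prop) T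
  have h₃ : ∫⁻ t₁ in A, ∫⁻ t₂, ∫⁻ s₁, ∫⁻ s₂ in Aᶜ, cyclicKer e p t₁ t₂ s₁ s₂ ≤
      ∫⁻ w, (e ⋆ₗ p) w * (e ⋆ₗ p) w * ENNReal.ofReal (min |w| T) := by
    have h : ∀ t₁ t₂, ∫⁻ s₁, ∫⁻ s₂ in Aᶜ, cyclicKer e p t₁ t₂ s₁ s₂ =
        ∫⁻ s₂ in Aᶜ, ∫⁻ s₁, cyclicKer e p t₁ t₂ s₁ s₂ := fun t₁ t₂ ↦
      lintegral_lintegral_swap (by fun_prop)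
    have h' : ∀ t₁, ∫⁻ t₂, ∫⁻ s₂ in Aᶜ, ∫⁻ s₁, cyclicKer e p t₁ t₂ s₁ s₂ =
        ∫⁻ s₂ in Aᶜ, ∫⁻ t₂, ∫⁻ s₁, cyclicKer e p t₁ t₂ s₁ s₂ := fun t₁ ↦
      lintegral_lintegral_swap (by fun_prop)
    simp_rw [h, h', lintegral_cyclicKer_t₂_s₁ he hp he' hp']
    exact setLIntegral_setLIntegral_compl_le (by fun_prop) T
  have hs₂ : ∀ t₁ t₂ s₁, ∫⁻ s₂, cyclicKer e p t₁ t₂ s₁ s₂ =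
      (∫⁻ s₂ in Aᶜ, cyclicKer e p t₁ t₂ s₁ s₂) + ∫⁻ s₂ in A, cyclicKer e p t₁ t₂ s₁ s₂ :=
    fun t₁ t₂ s₁ ↦ by rw [add_comm, lintegral_add_compl _ hA]
  calc ENNReal.ofReal T * ∫⁻ w, (e ⋆ₗ e) w * (p ⋆ₗ p) w
      = ∫⁻ t₁ in A, ∫⁻ t₂, ∫⁻ s₁, ∫⁻ s₂, cyclicKer e p t₁ t₂ s₁ s₂ := by
        simp_rw [lintegral_cyclicKer he hp he' hp']
        rw [setLIntegral_const, volume_Ioc, sub_zero, mul_comm]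
    _ = (∫⁻ t₁ in A, ∫⁻ t₂ in Aᶜ, ∫⁻ s₁, ∫⁻ s₂, cyclicKer e p t₁ t₂ s₁ s₂) +
        ∫⁻ t₁ in A, ∫⁻ t₂ in A, ∫⁻ s₁, ∫⁻ s₂, cyclicKer e p t₁ t₂ s₁ s₂ := by
        rw [← lintegral_add_left (by fun_prop)]
        refine lintegral_congr fun t₁ ↦ ?_
        rw [add_comm, lintegral_add_compl _ hA]
    _ = (∫⁻ t₁ in A, ∫⁻ t₂ in Aᶜ, ∫⁻ s₁, ∫⁻ s₂, cyclicKer e p t₁ t₂ s₁ s₂) +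
        ((∫⁻ t₁ in A, ∫⁻ t₂ in A, ∫⁻ s₁ in Aᶜ, ∫⁻ s₂, cyclicKer e p t₁ t₂ s₁ s₂) +
        ∫⁻ t₁ in A, ∫⁻ t₂ in A, ∫⁻ s₁ in A, ∫⁻ s₂, cyclicKer e p t₁ t₂ s₁ s₂) := by
        congr 1
        rw [← lintegral_add_left (by fun_prop)]
        refine lintegral_congr fun t₁ ↦ ?_
        rw [← lintegral_add_left (by fun_prop)]
        refine lintegral_congr fun t₂ ↦ ?_
        rw [add_comm, lintegral_add_compl _ hA]
    _ = (∫⁻ t₁ in A, ∫⁻ t₂ in Aᶜ, ∫⁻ s₁, ∫⁻ s₂, cyclicKer e p t₁ t₂ s₁ s₂) +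
        ((∫⁻ t₁ in A, ∫⁻ t₂ in A, ∫⁻ s₁ in Aᶜ, ∫⁻ s₂, cyclicKer e p t₁ t₂ s₁ s₂) +
        ((∫⁻ t₁ in A, ∫⁻ t₂ in A, ∫⁻ s₁ in A, ∫⁻ s₂ in Aᶜ, cyclicKer e p t₁ t₂ s₁ s₂) +
        ∫⁻ t₁ in A, ∫⁻ t₂ in A, ∫⁻ s₁ in A, ∫⁻ s₂ in A, cyclicKer e p t₁ t₂ s₁ s₂)) := by
        congr 2
        rw [← lintegral_add_left (by fun_prop)]
        refine lintegral_congr fun t₁ ↦ ?_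
        rw [← lintegral_add_left (by fun_prop)]
        refine lintegral_congr fun t₂ ↦ ?_
        rw [← lintegral_add_left (by fun_prop)]
        exact lintegral_congr fun s₁ ↦ hs₂ t₁ t₂ s₁
    _ ≤ _ := by
        simp only [← add_assoc]
        refine add_le_add (add_le_add (add_le_add h₁ ?_) ?_) le_rfl
        · exact (lintegral_mono fun t₁ ↦ setLIntegral_le_lintegral A _).trans h₂
        · refine (lintegral_mono fun t₁ ↦ ?_).trans h₃
          refine (lintegral_mono fun t₂ ↦ ?_).trans (setLIntegral_le_lintegral A _)
          exact setLIntegral_le_lintegral A _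

lemma lintegral_cyclicKer_box_le (he : Measurable e) (hp : Measurable p) (he' : e.Even)
    (hp' : p.Even) (T : ℝ) :
    ∫⁻ t₁ in Ioc 0 T, ∫⁻ t₂ in Ioc 0 T, ∫⁻ s₁ in Ioc 0 T, ∫⁻ s₂ in Ioc 0 T,
        cyclicKer e p t₁ t₂ s₁ s₂ ≤
      ENNReal.ofReal T * ∫⁻ w, (e ⋆ₗ e) w * (p ⋆ₗ p) w := by
  calc _ ≤ ∫⁻ t₁ in Ioc 0 T, ∫⁻ t₂, ∫⁻ s₁, ∫⁻ s₂, cyclicKer e p t₁ t₂ s₁ s₂ := by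
        refine lintegral_mono fun t₁ ↦ ?_
        refine (lintegral_mono fun t₂ ↦ ?_).trans (setLIntegral_le_lintegral _ _)
        refine (lintegral_mono fun s₁ ↦ ?_).trans (setLIntegral_le_lintegral _ _)
        exact setLIntegral_le_lintegral _ _
    _ = _ := by
        simp_rw [lintegral_cyclicKer he hp he' hp']
        rw [setLIntegral_const, volume_Ioc, sub_zero, mul_comm]

lemma integral_eq_toReal_lintegral {μ : Measure ℝ} {f : ℝ → ℝ} {F : ℝ → ℝ≥0∞}
    (hF : Measurable F) (hfin : ∫⁻ x, F x ∂μ ≠ ⊤) (h : ∀ x, F x ≠ ⊤ → f x = (F x).toReal) :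
    ∫ x, f x ∂μ = (∫⁻ x, F x ∂μ).toReal := by
  have hae := ae_lt_top hF hfin
  rw [← integral_toReal hF.aemeasurable hae]
  exact integral_congr_ae (hae.mono fun x hx ↦ h x hx.ne)

lemma integral_toReal_cyclicKer (he : Measurable e) (hp : Measurable p)
    {T : ℝ} (hT : 0 ≤ T)
    (hfin : ∫⁻ t₁ in Ioc 0 T, ∫⁻ t₂ in Ioc 0 T, ∫⁻ s₁ in Ioc 0 T, ∫⁻ s₂ in Ioc 0 T,
        cyclicKer e p t₁ t₂ s₁ s₂ ≠ ⊤) :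
    ∫ t₁ in (0 : ℝ)..T, ∫ t₂ in (0 : ℝ)..T, ∫ s₁ in (0 : ℝ)..T, ∫ s₂ in (0 : ℝ)..T,
        (cyclicKer e p t₁ t₂ s₁ s₂).toReal =
      (∫⁻ t₁ in Ioc 0 T, ∫⁻ t₂ in Ioc 0 T, ∫⁻ s₁ in Ioc 0 T, ∫⁻ s₂ in Ioc 0 T,
        cyclicKer e p t₁ t₂ s₁ s₂).toReal := by
  simp_rw [intervalIntegral.integral_of_le hT]
  refine integral_eq_toReal_lintegral (by fun_prop) hfin fun t₁ h₁ ↦ ?_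
  refine integral_eq_toReal_lintegral (by fun_prop) h₁ fun t₂ h₂ ↦ ?_
  refine integral_eq_toReal_lintegral (by fun_prop) h₂ fun s₁ h₃ ↦ ?_
  exact integral_eq_toReal_lintegral (by fun_prop) h₃ fun s₂ _ ↦ rfl

end CyclicIntegral

section RieszLaplace

lemma ae_ne_zero : ∀ᵐ x : ℝ, x ≠ 0 := compl_mem_ae_iff.2 (measure_singleton 0)

lemma lintegral_rieszKer_error_le {f : ℝ → ℝ≥0∞} {a k T : ℝ} (ha : -1 < a) (ha' : a < -1 / 2)
    (hT : 0 < T) (hk : 0 ≤ k) (hf : ∀ w ≠ 0, f w ≤ ENNReal.ofReal k * rieszKer (2 * a) w) :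
    ∫⁻ w, f w * ENNReal.ofReal (min |w| T) ≤
      ENNReal.ofReal (k * (2 * (1 / (2 * a + 2) - 1 / (2 * a + 1))) * T ^ (2 * a + 2)) := by
  calc ∫⁻ w, f w * ENNReal.ofReal (min |w| T)
      ≤ ∫⁻ w, ENNReal.ofReal k * (rieszKer (2 * a) w * ENNReal.ofReal (min |w| T)) := by
        refine lintegral_mono_ae (ae_ne_zero.mono fun w hw ↦ ?_)
        rw [← mul_assoc]
        exact mul_le_mul_left (hf w hw) _
    _ = _ := by
        rw [lintegral_const_mul' _ _ ENNReal.ofReal_ne_top,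
          lintegral_rieszKer_mul_min (by linarith) (by linarith) hT, ← ENNReal.ofReal_mul hk]
        congr 1; ring

lemma lconvolution_le_of_le {f g h : ℝ → ℝ≥0∞} {k : ℝ}
    (hfg : ∀ w ≠ 0, f w ≤ ENNReal.ofReal k * g w) (w : ℝ) :
    (h ⋆ₗ f) w ≤ ENNReal.ofReal k * (h ⋆ₗ g) w := by
  rw [lconvolution_comm (f := h), lconvolution_comm (f := h), lconvolution_def, lconvolution_def,
    ← lintegral_const_mul' _ _ ENNReal.ofReal_ne_top]
  refine lintegral_mono_ae (ae_ne_zero.mono fun y hy ↦ ?_)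
  rw [← mul_assoc]
  exact mul_le_mul_left (hfg y hy) _

lemma lintegral_rieszKer_mul_expKer_mul_abs {b : ℝ} (hb : -1 < b) :
    ∫⁻ w, expKer w * rieszKer b w * ENNReal.ofReal |w| = ENNReal.ofReal (2 * Gamma (b + 2)) := by
  unfold expKer rieszKer
  rw [lintegral_comp_abs fun w ↦ ENNReal.ofReal (exp (-w)) * ENNReal.ofReal (w ^ b) *
    ENNReal.ofReal w, ENNReal.ofReal_mul (by simp), ← setLIntegral_exp_mul_rpow (by linarith),
    ENNReal.ofReal_ofNat]
  congr 1
  refine setLIntegral_congr_fun measurableSet_Ioi fun w (hw : 0 < w) ↦ ?_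
  rw [← ENNReal.ofReal_mul (exp_pos _).le, ← ENNReal.ofReal_mul (by positivity),
    show b + 2 - 1 = b + 1 by ring, rpow_add_one hw.ne', mul_assoc]

/-- The constant `c` in `|·|^a ⋆ |·|^a = c |·|^(2a+1)`. -/
noncomputable def rieszConst (a : ℝ) : ℝ :=
  ProbabilityTheory.beta (a + 1) (a + 1) + 2 * ProbabilityTheory.beta (-2 * a - 1) (a + 1)

lemma rieszConst_pos {a : ℝ} (ha : -1 < a) (ha' : a < -1 / 2) : 0 < rieszConst a := by
  have := ProbabilityTheory.beta_pos (α := -2 * a - 1) (β := a + 1) (by linarith) (by linarith)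
  have := ProbabilityTheory.beta_pos (α := a + 1) (β := a + 1) (by linarith) (by linarith)
  unfold rieszConst; linarith

lemma rieszKer_lconvolution_rieszKer {a w : ℝ} (ha : -1 < a) (ha' : a < -1 / 2) (hw : w ≠ 0) :
    (rieszKer a ⋆ₗ rieszKer a) w = ENNReal.ofReal (rieszConst a) * rieszKer (2 * a + 1) w := by
  rw [rieszKer_lconvolution_self hw, rieszKer_lconvolution_self_one ha ha', rieszConst]

lemma lintegral_expKer_conv_mul_rieszKer_conv {a : ℝ} (ha : -1 < a) (ha' : a < -1 / 2) :
    ∫⁻ w, (expKer ⋆ₗ expKer) w * (rieszKer a ⋆ₗ rieszKer a) w =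
      ENNReal.ofReal (rieszConst a * (2 * (Gamma (2 * a + 2) + Gamma (2 * a + 3)))) := by
  have h₁ := (Gamma_pos_of_pos (s := 2 * a + 2) (by linarith)).le
  have h₂ := (Gamma_pos_of_pos (s := 2 * a + 3) (by linarith)).le
  calc ∫⁻ w, (expKer ⋆ₗ expKer) w * (rieszKer a ⋆ₗ rieszKer a) w
      = ∫⁻ w, ENNReal.ofReal (rieszConst a) *
          ENNReal.ofReal ((1 + |w|) * exp (-|w|) * |w| ^ (2 * a + 1)) := by
        refine lintegral_congr_ae (ae_ne_zero.mono fun w hw ↦ ?_)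
        simp only
        rw [expKer_lconvolution_expKer, rieszKer_lconvolution_rieszKer ha ha' hw, rieszKer,
          mul_left_comm, ← ENNReal.ofReal_mul (p := (1 + |w|) * exp (-|w|)) (by positivity)]
    _ = ENNReal.ofReal (rieszConst a) * (2 * ∫⁻ w in Ioi 0,
          ENNReal.ofReal ((1 + w) * exp (-w) * w ^ (2 * a + 1))) := by
        rw [lintegral_const_mul' _ _ ENNReal.ofReal_ne_top,
          lintegral_comp_abs fun w ↦ ENNReal.ofReal ((1 + w) * exp (-w) * w ^ (2 * a + 1))]
    _ = ENNReal.ofReal (rieszConst a) * (2 * ∫⁻ w in Ioi 0,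
          (ENNReal.ofReal (exp (-w) * w ^ (2 * a + 2 - 1)) +
            ENNReal.ofReal (exp (-w) * w ^ (2 * a + 3 - 1)))) := by
        congr 2
        refine setLIntegral_congr_fun measurableSet_Ioi fun w (hw : 0 < w) ↦ ?_
        rw [← ENNReal.ofReal_add (by positivity) (by positivity),
          show 2 * a + 2 - 1 = 2 * a + 1 by ring, show 2 * a + 3 - 1 = 2 * a + 1 + 1 by ring,
          rpow_add_one hw.ne' (2 * a + 1)]
        congr 1; ring
    _ = _ := by
        rw [lintegral_add_left (by fun_prop), setLIntegral_exp_mul_rpow (by linarith),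
          setLIntegral_exp_mul_rpow (by linarith), ← ENNReal.ofReal_add h₁ h₂,
          ← ENNReal.ofReal_ofNat, ← ENNReal.ofReal_mul (by simp),
          ← ENNReal.ofReal_mul (rieszConst_pos ha ha').le]

lemma exists_boxIntegral_error {a : ℝ} (ha : -1 < a) (ha' : a < -1 / 2) :
    ∃ K ≥ 0, ∀ T ≥ 1,
      |(∫⁻ t₁ in Ioc 0 T, ∫⁻ t₂ in Ioc 0 T, ∫⁻ s₁ in Ioc 0 T, ∫⁻ s₂ in Ioc 0 T,
        cyclicKer expKer (rieszKer a) t₁ t₂ s₁ s₂).toReal -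
          T * (rieszConst a * (2 * (Gamma (2 * a + 2) + Gamma (2 * a + 3))))| ≤
        K * T ^ (2 * a + 2) := by
  obtain ⟨k, hk, hke⟩ : ∃ k : ℝ, 0 ≤ k ∧ ∀ w ≠ 0,
      (expKer ⋆ₗ rieszKer a) w ≤ ENNReal.ofReal k * rieszKer a w :=
    have : 0 < a + 1 := by linarith
    ⟨_, by positivity, fun w hw ↦ expKer_lconvolution_rieszKer_le ha (by linarith) hw⟩
  obtain ⟨l, hl, hle⟩ : ∃ l : ℝ, 0 ≤ l ∧ ∀ w ≠ 0,
      (expKer ⋆ₗ rieszKer (2 * a + 1)) w ≤ ENNReal.ofReal l * rieszKer (2 * a + 1) w :=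
    have : 0 < 2 * a + 1 + 1 := by linarith
    ⟨_, by positivity, fun w hw ↦ expKer_lconvolution_rieszKer_le (by linarith) (by linarith) hw⟩
  have hc := rieszConst_pos ha ha'
  have hG₁ := (Gamma_pos_of_pos (s := 2 * a + 2) (by linarith)).le
  have hG₂ := (Gamma_pos_of_pos (s := 2 * a + 3) (by linarith)).le
  set m := k * k * (2 * (1 / (2 * a + 2) - 1 / (2 * a + 1))) with hm_def
  have hm : 0 ≤ m := by
    have : 1 / (2 * a + 1) ≤ 0 := one_div_nonpos.2 (by linarith)
    have : 0 ≤ 1 / (2 * a + 2) := one_div_nonneg.2 (by linarith)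
    refine mul_nonneg (by positivity) (by linarith)
  set n := rieszConst a * l * (2 * Gamma (2 * a + 3)) with hn_def
  have hn : 0 ≤ n := by positivity
  refine ⟨m + n + m, by positivity, fun T hT ↦ ?_⟩
  have hT0 : 0 < T := by linarith
  have hT1 : 1 ≤ T ^ (2 * a + 2) := one_le_rpow hT (by linarith)
  have b₁ : ∫⁻ w, rieszKer a w * (expKer ⋆ₗ rieszKer a ⋆ₗ expKer) w * ENNReal.ofReal (min |w| T) ≤
      ENNReal.ofReal (m * T ^ (2 * a + 2)) := by
    refine lintegral_rieszKer_error_le ha ha' hT0 (by positivity) fun w hw ↦ ?_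
    rw [lconvolution_comm (f := rieszKer a), ← rieszKer_mul_self, ENNReal.ofReal_mul hk]
    refine (mul_le_mul_right ((lconvolution_le_of_le hke w).trans
      (mul_le_mul_right (hke w hw) _)) _).trans (le_of_eq (by ring))
  have b₂ : ∫⁻ w, expKer w * ((rieszKer a ⋆ₗ expKer) ⋆ₗ rieszKer a) w *
      ENNReal.ofReal (min |w| T) ≤ ENNReal.ofReal (n * T ^ (2 * a + 2)) := by
    calc _ ≤ ∫⁻ w, ENNReal.ofReal (rieszConst a * l) *
          (expKer w * rieszKer (2 * a + 1) w * ENNReal.ofReal |w|) := by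
          refine lintegral_mono_ae (ae_ne_zero.mono fun w hw ↦ ?_)
          rw [lconvolution_comm (f := rieszKer a), ← lconvolution_assoc (by fun_prop)
            (by fun_prop) (by fun_prop), ENNReal.ofReal_mul hc.le]
          have h := (lconvolution_le_of_le (h := expKer)
            (fun w hw ↦ (rieszKer_lconvolution_rieszKer ha ha' hw).le) w).trans
              (mul_le_mul_right (hle w hw) _)
          calc _ ≤ expKer w * (ENNReal.ofReal (rieszConst a) * (ENNReal.ofReal l *
                rieszKer (2 * a + 1) w)) * ENNReal.ofReal |w| := by
                gcongr
                exact min_le_left _ _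
            _ = _ := by ring
      _ = ENNReal.ofReal n := by
          rw [lintegral_const_mul' _ _ ENNReal.ofReal_ne_top,
            lintegral_rieszKer_mul_expKer_mul_abs (by linarith),
            ← ENNReal.ofReal_mul (by positivity), hn_def]
          congr 4; ring
      _ ≤ _ := ENNReal.ofReal_le_ofReal (le_mul_of_one_le_right hn hT1)
  have b₃ : ∫⁻ w, (expKer ⋆ₗ rieszKer a) w * (expKer ⋆ₗ rieszKer a) w *
      ENNReal.ofReal (min |w| T) ≤ ENNReal.ofReal (m * T ^ (2 * a + 2)) := by
    refine lintegral_rieszKer_error_le ha ha' hT0 (by positivity) fun w hw ↦ ?_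
    rw [← rieszKer_mul_self, ENNReal.ofReal_mul hk]
    exact (mul_le_mul' (hke w hw) (hke w hw)).trans (le_of_eq (by ring))
  have hlow := (lintegral_cyclicKer_le measurable_expKer (measurable_rieszKer a) even_expKer
    (even_rieszKer a) T).trans (add_le_add (add_le_add (add_le_add b₁ b₂) b₃) le_rfl)
  have hup := lintegral_cyclicKer_box_le measurable_expKer (measurable_rieszKer a) even_expKer
    (even_rieszKer a) T
  rw [lintegral_expKer_conv_mul_rieszKer_conv ha ha', ← ENNReal.ofReal_mul hT0.le] at hlow hup
  set N := ∫⁻ t₁ in Ioc 0 T, ∫⁻ t₂ in Ioc 0 T, ∫⁻ s₁ in Ioc 0 T, ∫⁻ s₂ in Ioc 0 T,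
    cyclicKer expKer (rieszKer a) t₁ t₂ s₁ s₂
  have hN : N ≠ ⊤ := (hup.trans_lt ENNReal.ofReal_lt_top).ne
  rw [← ENNReal.ofReal_toReal hN] at hlow hup
  rw [← ENNReal.ofReal_add (by positivity) (by positivity),
    ← ENNReal.ofReal_add (by positivity) (by positivity),
    ← ENNReal.ofReal_add (by positivity) (by positivity),
    ENNReal.ofReal_le_ofReal_iff (by positivity)] at hlow
  rw [ENNReal.ofReal_le_ofReal_iff (by positivity)] at hup
  rw [abs_le]
  constructor <;> nlinarith

lemma rieszConst_mul_Gamma {H : ℝ} (hH : 1 / 2 < H) (hH' : H < 3 / 4) :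
    (2 * H - 1) ^ 2 * (rieszConst (2 * H - 2) * (Gamma (4 * H - 2) + Gamma (4 * H - 1))) =
      Gamma (2 * H) ^ 2 * (4 * H - 1) * (1 - 1 / cos (2 * H * π)) := by
  have g₁ : Gamma (2 * H) = (2 * H - 1) * Gamma (2 * H - 1) := by
    rw [← Gamma_add_one (by linarith)]; congr 1; ring
  have g₂ : Gamma (4 * H - 1) = (4 * H - 2) * Gamma (4 * H - 2) := by
    rw [← Gamma_add_one (by linarith)]; congr 1; ring
  have r₁ := Gamma_mul_Gamma_one_sub (2 * H - 1)
  have r₂ := Gamma_mul_Gamma_one_sub (4 * H - 2)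
  have s₁ : sin (π * (2 * H - 1)) = - sin (2 * H * π) := by
    rw [← sin_sub_pi]; congr 1; ring
  have s₂ : sin (π * (4 * H - 2)) = 2 * sin (2 * H * π) * cos (2 * H * π) := by
    rw [← sin_two_mul, ← sin_sub_two_pi (2 * _)]; congr 1; ring
  have p₁ := Gamma_pos_of_pos (s := 2 * H - 1) (by linarith)
  have p₂ := Gamma_pos_of_pos (s := 4 * H - 2) (by linarith)
  have p₃ := Gamma_pos_of_pos (s := 2 - 2 * H) (by linarith)
  have hsin : sin (2 * H * π) < 0 := by
    have := sin_pos_of_pos_of_lt_pi (x := π * (2 * H - 1)) (mul_pos pi_pos (by linarith))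
      (by nlinarith [pi_pos])
    linarith
  have hcos : cos (2 * H * π) < 0 :=
    cos_neg_of_pi_div_two_lt_of_lt (by nlinarith [pi_pos]) (by nlinarith [pi_pos])
  rw [s₁, show 1 - (2 * H - 1) = 2 - 2 * H by ring] at r₁
  rw [s₂, show 1 - (4 * H - 2) = 3 - 4 * H by ring] at r₂
  have hb : rieszConst (2 * H - 2) * Gamma (4 * H - 2) =
      Gamma (2 * H - 1) ^ 2 * (1 - 1 / cos (2 * H * π)) := by
    have e₁ : Gamma (2 * H - 1) = π / -sin (2 * H * π) / Gamma (2 - 2 * H) := by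
      rw [← r₁, mul_div_cancel_right₀ _ p₃.ne']
    have e₂ : Gamma (3 - 4 * H) = π / (2 * sin (2 * H * π) * cos (2 * H * π)) /
        Gamma (4 * H - 2) := by
      rw [← r₂, mul_div_cancel_left₀ _ p₂.ne']
    unfold rieszConst ProbabilityTheory.beta
    rw [show 2 * H - 2 + 1 = 2 * H - 1 by ring, show -2 * (2 * H - 2) - 1 = 3 - 4 * H by ring,
      show 2 * H - 1 + (2 * H - 1) = 4 * H - 2 by ring,
      show 3 - 4 * H + (2 * H - 1) = 2 - 2 * H by ring, e₂, e₁]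
    generalize Gamma (4 * H - 2) = x at p₂ ⊢
    generalize Gamma (2 - 2 * H) = y at p₃ ⊢
    have := hsin.ne
    have := hcos.ne
    field_simp
    ring
  rw [g₁, g₂]
  linear_combination (2 * H - 1) ^ 2 * (4 * H - 1) * hb

lemma toReal_cyclicKer (a t₁ t₂ s₁ s₂ : ℝ) :
    (cyclicKer expKer (rieszKer a) t₁ t₂ s₁ s₂).toReal =
      exp (-|t₁ - s₁| - |t₂ - s₂|) * |t₂ - t₁| ^ a * |s₁ - s₂| ^ a := by
  rw [cyclicKer, ENNReal.toReal_mul, ENNReal.toReal_mul, ENNReal.toReal_mul, expKer, expKer,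
    rieszKer, rieszKer, ENNReal.toReal_ofReal (exp_pos _).le,
    ENNReal.toReal_ofReal (exp_pos _).le, ENNReal.toReal_ofReal (by positivity),
    ENNReal.toReal_ofReal (by positivity), sub_eq_add_neg (-|_|), exp_add]

end RieszLaplace

end FBmNorm

open FBmNorm

theorem stmt_8 (H : ℝ) (hH : H ∈ Set.Ioo (1/2 : ℝ) (3/4)) :
    ∃ C > (0 : ℝ), ∀ T ≥ (1 : ℝ),
      |fBmNormSq H T / (2 * T) -
        H ^ 2 * (Real.Gamma (2 * H)) ^ 2 * (4 * H - 1) * (1 - 1 / Real.cos (2 * H * π))|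
        ≤ C * T ^ (4 * H - 3) := by
  obtain ⟨hH₁, hH₂⟩ := hH
  have ha : -1 < 2 * H - 2 := by linarith
  have ha' : 2 * H - 2 < -1 / 2 := by linarith
  obtain ⟨K, hK, h⟩ := exists_boxIntegral_error ha ha'
  refine ⟨H ^ 2 * (2 * H - 1) ^ 2 / 2 * K + 1, by positivity, fun T hT ↦ ?_⟩
  have hT0 : 0 < T := by linarith
  have hfin := ((lintegral_cyclicKer_box_le measurable_expKer (measurable_rieszKer (2 * H - 2))
    even_expKer (even_rieszKer _) T).trans_lt (by
      rw [lintegral_expKer_conv_mul_rieszKer_conv ha ha', ← ENNReal.ofReal_mul hT0.le]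
      exact ENNReal.ofReal_lt_top)).ne
  have hN := integral_toReal_cyclicKer measurable_expKer (measurable_rieszKer (2 * H - 2))
    hT0.le hfin
  simp_rw [toReal_cyclicKer] at hN
  have hT' := h T hT
  rw [← hN, show 2 * (2 * H - 2) + 2 = (4 * H - 3) + 1 by ring, rpow_add_one hT0.ne'] at hT'
  have hconst := rieszConst_mul_Gamma hH₁ hH₂
  rw [show 4 * H - 3 + 1 = 4 * H - 2 by ring,
    show 2 * (2 * H - 2) + 3 = 4 * H - 1 by ring] at hT'
  rw [fBmNormSq]
  set N := ∫ t₁ in (0:ℝ)..T, ∫ t₂ in (0:ℝ)..T, ∫ s₁ in (0:ℝ)..T, ∫ s₂ in (0:ℝ)..T,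
      Real.exp (-|t₁ - s₁| - |t₂ - s₂|) * |t₂ - t₁| ^ (2 * H - 2) * |s₁ - s₂| ^ (2 * H - 2)
  set G := rieszConst (2 * H - 2) * (Gamma (4 * H - 2) + Gamma (4 * H - 1)) with hG
  have hrew : H ^ 2 * (2 * H - 1) ^ 2 * N / (2 * T) -
      H ^ 2 * Gamma (2 * H) ^ 2 * (4 * H - 1) * (1 - 1 / cos (2 * H * π)) =
      H ^ 2 * (2 * H - 1) ^ 2 / (2 * T) * (N - T * (rieszConst (2 * H - 2) *
        (2 * (Gamma (4 * H - 2) + Gamma (4 * H - 1))))) := by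
    rw [mul_left_comm _ 2, ← hG]
    have : H ^ 2 * Gamma (2 * H) ^ 2 * (4 * H - 1) * (1 - 1 / cos (2 * H * π)) =
      H ^ 2 * ((2 * H - 1) ^ 2 * G) := by rw [hconst]; ring
    rw [this]
    field_simp
  rw [hrew, abs_mul, abs_of_nonneg (by positivity)]
  calc _ ≤ H ^ 2 * (2 * H - 1) ^ 2 / (2 * T) * (K * (T ^ (4 * H - 3) * T)) := by gcongr
    _ = H ^ 2 * (2 * H - 1) ^ 2 / 2 * K * T ^ (4 * H - 3) := by field_simp
    _ ≤ _ := by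
      have := rpow_pos_of_pos hT0 (4 * H - 3)
      linarith
end
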